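/- For every smooth function α : W → (0,∞), the set Γ is a periodic orbit of the perturbed planar system dv/dt = μ(v)𝕁∇𝓗(v) − α(v)(𝓗(v)−h)∇𝓗(v), v ∈ W, and Γ is orbitally phase asymptotically stable with respect to perturbations in W. -/

import Mathlib

open scoped RealInnerProductSpace

noncomputable section

abbrev E2 := EuclideanSpace ℝ (Fin 2)

/-- The matrix `𝕁 = [[0,1],[−1,0]]` acting on `ℝ²`. -/
noncomputable def J2 (w : E2) : E2 :=
  (WithLp.equiv 2 (Fin 2 → ℝ)).symm ![w 1, -(w 0)]

/-- `x` is a forward-in-time solution of `v' = Y v` in `V` with `x 0 = x₀`. -/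
def IsForwardSolution {E : Type*} [NormedAddCommGroup E] [NormedSpace ℝ E]
    (Y : E → E) (V : Set E) (x₀ : E) (x : ℝ → E) : Prop :=
  x 0 = x₀ ∧ ∀ t : ℝ, 0 ≤ t → x t ∈ V ∧ HasDerivWithinAt x (Y (x t)) (Set.Ici 0) t

/-- Orbital stability of the set `Γ` for the system `v' = Y v` on `V`,
with respect to perturbations (initial conditions) in `S`. -/
def OrbitallyStable {E : Type*} [NormedAddCommGroup E] [NormedSpace ℝ E]
    (Y : E → E) (V S Γ : Set E) : Prop :=
  ∀ ε > 0, ∃ δ' > 0, ∀ x₀ ∈ S, Metric.infDist x₀ Γ < δ' →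
    ∀ x : ℝ → E, IsForwardSolution Y V x₀ x → ∀ t ≥ (0:ℝ), Metric.infDist (x t) Γ < ε

/-- Orbital phase asymptotic stability of the periodic orbit `Γ` (traced by `γ`)
for the system `v' = Y v` on `V`, with respect to perturbations in `S`. -/
def OrbitallyPhaseAsymptoticallyStable {E : Type*} [NormedAddCommGroup E] [NormedSpace ℝ E]
    (Y : E → E) (V S : Set E) (γ : ℝ → E) (Γ : Set E) : Prop :=
  ∃ δ > 0,
    (∀ x₀ ∈ S, Metric.infDist x₀ Γ < δ → ∃ x : ℝ → E, IsForwardSolution Y V x₀ x) ∧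
    (∀ ε > 0, ∃ δ' > 0, δ' ≤ δ ∧ ∀ x₀ ∈ S, Metric.infDist x₀ Γ < δ' →
      ∀ x : ℝ → E, IsForwardSolution Y V x₀ x → ∀ t ≥ (0:ℝ), Metric.infDist (x t) Γ < ε) ∧
    (∀ x₀ ∈ S, Metric.infDist x₀ Γ < δ → ∀ x : ℝ → E, IsForwardSolution Y V x₀ x →
      Filter.Tendsto (fun t => Metric.infDist (x t) Γ) Filter.atTop (nhds 0) ∧
      ∃ θ₀ : ℝ, Filter.Tendsto (fun t => dist (x t) (γ (t + θ₀))) Filter.atTop (nhds 0))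

open Set Filter Topology Metric

section GlobalExistence

variable {E : Type*} [NormedAddCommGroup E] [NormedSpace ℝ E] [CompleteSpace E]

/-- A bounded Lipschitz vector field has forward solutions defined for all nonnegative times. -/
theorem exists_forward_solution_of_lipschitz_of_bounded {v : E → E} {K M : NNReal}
    (hv : LipschitzWith K v) (hM : ∀ y, ‖v y‖ ≤ M) (x₀ : E) :
    ∃ x : ℝ → E, x 0 = x₀ ∧ ∀ t, 0 ≤ t → HasDerivWithinAt x (v (x t)) (Ici 0) t := by
  have hloc (n : ℕ) : ∃ β : ℝ → E, β 0 = x₀ ∧ ∀ t ∈ Icc (0 : ℝ) (n + 1),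
      HasDerivWithinAt β (v (β t)) (Icc (0 : ℝ) (n + 1)) t := by
    have h0 : (0 : ℝ) ∈ Icc (0 : ℝ) (n + 1) := ⟨le_rfl, by positivity⟩
    have hpl : IsPicardLindelof (fun _ => v) (⟨0, h0⟩ : Icc (0 : ℝ) (n + 1)) x₀
        (M * (n + 1)) 0 M K :=
      { lipschitzOnWith := fun _ _ => hv.lipschitzOnWith
        continuousOn := fun _ _ => continuousOn_const
        norm_le := fun _ _ y _ => hM y
        mul_max_le := by
          have : (0 : ℝ) ≤ n + 1 := by positivity
          simp [max_eq_left this] }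
    exact hpl.exists_eq_forall_mem_Icc_hasDerivWithinAt₀
  choose β hβ0 hβ using hloc
  have hright {n : ℕ} {t : ℝ} (ht : t ∈ Ico (0 : ℝ) (n + 1)) :
      HasDerivWithinAt (β n) (v (β n t)) (Ici t) t :=
    (((hβ n t (Ico_subset_Icc_self ht)).mono (Icc_subset_Icc_left ht.1)).mono_of_mem_nhdsWithin
      (Icc_mem_nhdsGE ht.2))
  have hagree {n m : ℕ} (hnm : n ≤ m) : EqOn (β n) (β m) (Icc 0 (n + 1)) := by
    have hnm' : (n : ℝ) + 1 ≤ m + 1 := by exact_mod_cast Nat.succ_le_succ hnm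
    refine ODE_solution_unique (v := fun _ => v) (K := K) (fun _ => hv)
      (fun t ht => (hβ n t ht).continuousWithinAt) (fun t ht => hright ht)
      (fun t ht => ((hβ m t ⟨ht.1, ht.2.trans hnm'⟩).continuousWithinAt).mono
        (Icc_subset_Icc_right hnm')) (fun t ht => hright ⟨ht.1, ht.2.trans_le hnm'⟩) ?_
    rw [hβ0, hβ0]
  have hval {N : ℕ} {s : ℝ} (hs : s ∈ Ico (0 : ℝ) (N + 1)) : β ⌊s⌋₊ s = β N s := by
    refine hagree ?_ ⟨hs.1, (Nat.lt_floor_add_one s).le⟩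
    have : ⌊s⌋₊ < N + 1 := (Nat.floor_lt hs.1).2 (by exact_mod_cast hs.2)
    omega
  refine ⟨fun t => β ⌊t⌋₊ t, by simpa using hβ0 0, fun t ht => ?_⟩
  have htN : t ∈ Ico (0 : ℝ) (⌊t⌋₊ + 1) := ⟨ht, Nat.lt_floor_add_one t⟩
  have hmem : Ico (0 : ℝ) (⌊t⌋₊ + 1) ∈ 𝓝[Ici 0] t := by
    rw [← Ici_inter_Iio]
    exact inter_mem_nhdsWithin _ (Iio_mem_nhds htN.2)
  refine HasDerivWithinAt.mono_of_mem_nhdsWithin ?_ hmem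
  exact ((hβ ⌊t⌋₊ t (Ico_subset_Icc_self htN)).mono Ico_subset_Icc_self).congr
    (fun s hs => hval hs) rfl

end GlobalExistence

section AsymptoticPhase

variable {E : Type*} [NormedAddCommGroup E] [NormedSpace ℝ E] [CompleteSpace E]

/-- A forward solution converging exponentially fast to a periodic orbit has an asymptotic
phase. -/
theorem exists_asymptotic_phase {Y : E → E} {S Γ : Set E} {K : NNReal}
    (hY : LipschitzOnWith K Y S) {γ : ℝ → E} {T : ℝ} (hT : 0 < T)
    (hγ : ∀ t, HasDerivAt γ (Y (γ t)) t) (hper : Function.Periodic γ T)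
    (hΓ : Γ = γ '' Icc 0 T) (hγS : ∀ t, γ t ∈ S) {x : ℝ → E}
    (hx : ∀ t, 0 ≤ t → HasDerivWithinAt x (Y (x t)) (Ici 0) t) (hxS : ∀ t, 0 ≤ t → x t ∈ S)
    {A c : ℝ} (hc : 0 < c) (hdist : ∀ t, 0 ≤ t → infDist (x t) Γ ≤ A * Real.exp (-c * t)) :
    ∃ θ, Tendsto (fun t => dist (x t) (γ (t + θ))) atTop (𝓝 0) := by
  have hγc : Continuous γ := continuous_iff_continuousAt.2 fun t => (hγ t).continuousAt
  have hΓc : IsCompact Γ := hΓ ▸ isCompact_Icc.image hγc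
  have hΓne : Γ.Nonempty := hΓ ▸ ⟨γ 0, 0, ⟨le_rfl, hT.le⟩, rfl⟩
  have hshadow (n : ℕ) (θ : ℝ) {s : ℝ} (hs : s ∈ Icc 0 T) :
      dist (x (n * T + s)) (γ (θ + s)) ≤ dist (x (n * T)) (γ θ) * Real.exp (K * T) := by
    have hnT : 0 ≤ n * T := by positivity
    have hmaps : MapsTo (fun s => n * T + s) (Ici (0 : ℝ)) (Ici 0) := fun s hs =>
      add_nonneg hnT hs
    have hd {s : ℝ} (hs : 0 ≤ s) : HasDerivWithinAt (fun s => x (n * T + s))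
        (Y (x (n * T + s))) (Ici 0) s := by
      simpa [Function.comp_def] using (hx _ (hmaps hs)).scomp s
        ((hasDerivAt_id s).const_add (n * T)).hasDerivWithinAt hmaps
    have hg (s : ℝ) : HasDerivAt (fun s => γ (θ + s)) (Y (γ (θ + s))) s := by
      simpa [Function.comp_def] using (hγ (θ + s)).scomp s ((hasDerivAt_id s).const_add θ)
    have := dist_le_of_trajectories_ODE_of_mem (v := fun _ => Y) (K := K) (s := fun _ => S)
      (a := 0) (b := T) (f := fun s => x (n * T + s)) (g := fun s => γ (θ + s))
      (δ := dist (x (n * T)) (γ θ)) (fun _ _ => hY)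
      (fun s hs => ((hd hs.1).continuousWithinAt).mono Icc_subset_Ici_self)
      (fun s hs => (hd hs.1).mono (Ici_subset_Ici.2 hs.1)) (fun s hs => hxS _ (hmaps hs.1))
      (fun s _ => (hg s).continuousAt.continuousWithinAt) (fun s _ => (hg s).hasDerivWithinAt)
      (fun s _ => hγS _) (by simp) s hs
    refine this.trans ?_
    gcongr
    linarith [hs.2]
  have hproj (n : ℕ) : ∃ θ, dist (x (n * T)) (γ θ) ≤ A * Real.exp (-c * T) ^ n := by
    obtain ⟨y, hy, hyd⟩ := hΓc.exists_infDist_eq_dist hΓne (x (n * T))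
    rw [hΓ] at hy
    obtain ⟨θ, -, rfl⟩ := hy
    refine ⟨θ, hyd ▸ (hdist _ (by positivity)).trans_eq ?_⟩
    rw [← Real.exp_nat_mul]
    ring_nf
  have hq : Real.exp (-c * T) < 1 := Real.exp_lt_one_iff.2 (by nlinarith)
  have hcauchy : CauchySeq fun n : ℕ => x (n * T) := by
    refine cauchySeq_of_le_geometric (Real.exp (-c * T)) (A * (1 + Real.exp (K * T))) hq
      fun n => ?_
    obtain ⟨θ, hθ⟩ := hproj n
    have h1 := hshadow n θ ⟨hT.le, le_rfl⟩
    rw [hper θ] at h1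
    have h2 : ((n + 1 : ℕ) : ℝ) * T = n * T + T := by push_cast; ring
    rw [h2]
    calc dist (x (n * T)) (x (n * T + T))
        ≤ dist (x (n * T)) (γ θ) + dist (x (n * T + T)) (γ θ) := dist_triangle_right _ _ _
      _ ≤ dist (x (n * T)) (γ θ) * (1 + Real.exp (K * T)) := by linarith
      _ ≤ A * Real.exp (-c * T) ^ n * (1 + Real.exp (K * T)) := by gcongr
      _ = _ := by ring
  obtain ⟨p, hp⟩ := cauchySeq_tendsto_of_complete hcauchy
  have hpΓ : p ∈ Γ := by
    rw [hΓc.isClosed.mem_iff_infDist_zero hΓne]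
    refine tendsto_nhds_unique ((continuous_infDist_pt Γ).continuousAt.tendsto.comp hp)
      (squeeze_zero (fun _ => infDist_nonneg) (fun n => ?_) ?_
        (g := fun n : ℕ => A * Real.exp (-c * T) ^ n))
    · refine (hdist _ (by positivity)).trans_eq ?_
      rw [← Real.exp_nat_mul]
      ring_nf
    · simpa using (tendsto_pow_atTop_nhds_zero_of_lt_one (Real.exp_pos _).le hq).const_mul A
  rw [hΓ] at hpΓ
  obtain ⟨θ, -, rfl⟩ := hpΓ
  refine ⟨θ, ?_⟩
  have hfloor : Tendsto (fun t : ℝ => ⌊t / T⌋₊) atTop atTop :=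
    tendsto_nat_floor_atTop.comp (tendsto_id.atTop_div_const hT)
  have hlim : Tendsto (fun t : ℝ => dist (x (⌊t / T⌋₊ * T)) (γ θ) * Real.exp (K * T))
      atTop (𝓝 0) := by
    simpa using ((tendsto_iff_dist_tendsto_zero.1 hp).comp hfloor).mul_const (Real.exp (K * T))
  refine squeeze_zero' (Eventually.of_forall fun _ => dist_nonneg) ?_ hlim
  filter_upwards [eventually_ge_atTop 0] with t ht
  have h1 : ⌊t / T⌋₊ * T ≤ t := (le_div_iff₀ hT).1 (Nat.floor_le (by positivity))
  have h2 : t < (⌊t / T⌋₊ + 1) * T := (div_lt_iff₀ hT).1 (Nat.lt_floor_add_one _)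
  have := hshadow ⌊t / T⌋₊ θ (s := t - ⌊t / T⌋₊ * T) ⟨by linarith, by linarith⟩
  rwa [add_sub_cancel, show θ + (t - ⌊t / T⌋₊ * T) = t + θ - ⌊t / T⌋₊ * T by ring,
    hper.sub_nat_mul_eq] at this

end AsymptoticPhase

section Lyapunov

variable {E : Type*} [PseudoMetricSpace E]

/-- A function `g` decaying at a definite rate along a curve near `Γ`, and controlling the distance
to `Γ`, confines the curve near `Γ` and decays exponentially along it. -/
theorem infDist_lt_and_abs_le_of_hasDerivWithinAt {Γ : Set E} {g : E → ℝ} {r C c ρ : ℝ}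
    (hC0 : 0 ≤ C) (hC : ∀ y, infDist y Γ ≤ r → infDist y Γ ≤ C * |g y|)
    {x : ℝ → E} (hxc : ContinuousOn x (Ici 0))
    (hder : ∀ t, 0 ≤ t → infDist (x t) Γ ≤ r →
      ∃ a ≥ c, HasDerivWithinAt (g ∘ x) (-a * g (x t)) (Ici 0) t)
    (hρ : ρ ≤ r) (hc : 0 ≤ c) (hx0 : infDist (x 0) Γ ≤ r) (hg0 : C * |g (x 0)| < ρ)
    {t : ℝ} (ht : 0 ≤ t) :
    infDist (x t) Γ < ρ ∧ |g (x t)| ≤ |g (x 0)| * Real.exp (-c * t) := by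
  have hdecay {b : ℝ} (hb : 0 ≤ b) (hin : ∀ s ∈ Icc 0 b, infDist (x s) Γ ≤ r) :
      |g (x b)| ≤ |g (x 0)| * Real.exp (-c * b) := by
    choose! a hac ha using hder
    have hu (s : ℝ) (hs : s ∈ Icc 0 b) :
        HasDerivWithinAt (fun s => g (x s) ^ 2 * Real.exp (2 * c * s))
          (2 * (c - a s) * (g (x s) ^ 2 * Real.exp (2 * c * s))) (Ici 0) s := by
      have h1 := (ha s hs.1 (hin s hs)).pow 2
      have h2 : HasDerivWithinAt (fun s => Real.exp (2 * c * s))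
          (Real.exp (2 * c * s) * (2 * c)) (Ici 0) s := by
        simpa using (((hasDerivAt_id s).const_mul (2 * c)).exp).hasDerivWithinAt
      refine (h1.mul h2).congr_deriv ?_
      simp only [Function.comp_apply, Pi.pow_apply]
      push_cast
      ring
    have hanti : AntitoneOn (fun s => g (x s) ^ 2 * Real.exp (2 * c * s)) (Icc 0 b) := by
      refine antitoneOn_of_hasDerivWithinAt_nonpos (convex_Icc 0 b)
        (f' := fun s => 2 * (c - a s) * (g (x s) ^ 2 * Real.exp (2 * c * s)))
        (fun s hs => (hu s hs).continuousWithinAt.mono Icc_subset_Ici_self)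
        (fun s hs => (hu s (interior_subset hs)).mono
          (interior_subset.trans Icc_subset_Ici_self)) (fun s hs => ?_)
      have hs' := interior_subset hs
      have := hac s hs'.1 (hin s hs')
      exact mul_nonpos_of_nonpos_of_nonneg (by linarith) (by positivity)
    have h0 := hanti ⟨le_rfl, hb⟩ ⟨hb, le_rfl⟩ hb
    simp only [mul_zero, Real.exp_zero, mul_one] at h0
    refine abs_le_of_sq_le_sq ?_ (by positivity)
    have hexp : Real.exp (2 * c * b) * Real.exp (-c * b) ^ 2 = 1 := by
      rw [← Real.exp_nat_mul, ← Real.exp_add, Real.exp_eq_one_iff]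
      push_cast
      ring
    calc g (x b) ^ 2 = g (x b) ^ 2 * Real.exp (2 * c * b) * Real.exp (-c * b) ^ 2 := by
          rw [mul_assoc, hexp, mul_one]
      _ ≤ g (x 0) ^ 2 * Real.exp (-c * b) ^ 2 := by gcongr
      _ = _ := by rw [mul_pow, sq_abs]
  have hf : ContinuousOn (fun s => infDist (x s) Γ) (Ici 0) :=
    (continuous_infDist_pt Γ).comp_continuousOn hxc
  have hlt (s : ℝ) (hs : 0 ≤ s) : infDist (x s) Γ < ρ := by
    by_contra! hge
    have hcomp : IsCompact {u ∈ Icc 0 s | ρ ≤ infDist (x u) Γ} := by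
      refine isCompact_Icc.of_isClosed_subset ?_ (sep_subset _ _)
      exact (hf.mono Icc_subset_Ici_self).preimage_isClosed_of_isClosed isClosed_Icc isClosed_Ici
    obtain ⟨b, ⟨hb, hbρ⟩, hleast⟩ := hcomp.exists_isLeast ⟨s, ⟨hs, le_rfl⟩, hge⟩
    have h0 : infDist (x 0) Γ < ρ := (hC _ hx0).trans_lt hg0
    obtain ⟨u, hu, hux⟩ := intermediate_value_Icc hb.1 (hf.mono Icc_subset_Ici_self)
      ⟨h0.le, hbρ⟩
    have hub : u = b := le_antisymm hu.2 (hleast ⟨⟨hu.1, hu.2.trans hb.2⟩, hux.ge⟩)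
    subst hub
    have hin (w : ℝ) (hw : w ∈ Icc 0 u) : infDist (x w) Γ ≤ ρ := by
      by_contra! hlt
      have : u = w := le_antisymm (hleast ⟨⟨hw.1, hw.2.trans hb.2⟩, hlt.le⟩) hw.2
      subst this
      exact hlt.ne' hux
    have h1 := hdecay hb.1 fun w hw => (hin w hw).trans hρ
    have h2 : |g (x 0)| * Real.exp (-c * u) ≤ |g (x 0)| :=
      mul_le_of_le_one_right (abs_nonneg _) (Real.exp_le_one_iff.2 (by nlinarith [hb.1]))
    have h3 := hC (x u) (hux.le.trans hρ)
    have h4 := mul_le_mul_of_nonneg_left (h1.trans h2) hC0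
    dsimp only at hux
    linarith
  exact ⟨hlt t ht, hdecay ht fun s hs => (hlt s hs.1).le.trans hρ⟩

end Lyapunov

section LevelSet

variable {E : Type*} [PseudoMetricSpace E]

/-- A property holding near a nonempty compact set holds on one of its closed metric
neighbourhoods. -/
theorem exists_forall_infDist_le_of_eventually_nhdsSet {Γ : Set E} (hΓ : IsCompact Γ)
    (hne : Γ.Nonempty) {P : E → Prop} (hP : ∀ᶠ y in 𝓝ˢ Γ, P y) :
    ∃ r > 0, ∀ y, infDist y Γ ≤ r → P y := by
  obtain ⟨r, hr, hrP⟩ := (hasBasis_nhdsSet_cthickening hΓ).mem_iff.1 hP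
  refine ⟨r, hr, fun y hy => hrP ?_⟩
  rw [mem_cthickening_iff]
  exact (ENNReal.le_ofReal_iff_toReal_le (infEDist_ne_top hne) hr.le).2 hy

/-- A bound of one function by a multiple of another near each point of a compact set is uniform
near that set. -/
theorem exists_eventually_nhdsSet_le_mul {X : Type*} [TopologicalSpace X] {Γ : Set X}
    (hΓ : IsCompact Γ) {f g : X → ℝ} (hg : ∀ y, 0 ≤ g y)
    (h : ∀ p ∈ Γ, ∃ C, ∀ᶠ y in 𝓝 p, f y ≤ C * g y) :
    ∃ C, 0 ≤ C ∧ ∀ᶠ y in 𝓝ˢ Γ, f y ≤ C * g y := by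
  refine hΓ.induction_on (p := fun s => ∃ C, 0 ≤ C ∧ ∀ᶠ y in 𝓝ˢ s, f y ≤ C * g y)
    ⟨0, le_rfl, by simp⟩ (fun s t hst ⟨C, hC, ht⟩ => ⟨C, hC, ht.filter_mono (nhdsSet_mono hst)⟩)
    (fun s t ⟨C, hC, hs⟩ ⟨D, _, ht⟩ => ⟨max C D, le_max_of_le_left hC, ?_⟩) fun p hp => ?_
  · rw [nhdsSet_union, eventually_sup]
    exact ⟨hs.mono fun y hy => hy.trans (mul_le_mul_of_nonneg_right (le_max_left _ _) (hg y)),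
      ht.mono fun y hy => hy.trans (mul_le_mul_of_nonneg_right (le_max_right _ _) (hg y))⟩
  · obtain ⟨C, hC⟩ := h p hp
    obtain ⟨U, hU, hUo, hpU⟩ := mem_nhds_iff.1 hC
    refine ⟨U, mem_nhdsWithin_of_mem_nhds (hUo.mem_nhds hpU), max C 0, le_max_right _ _, ?_⟩
    filter_upwards [hUo.mem_nhdsSet_self] with y hy
    exact (hU hy).trans (mul_le_mul_of_nonneg_right (le_max_left _ _) (hg y))

end LevelSet

section TransverseCoordinates

variable {E : Type*} [NormedAddCommGroup E] [InnerProductSpace ℝ E] [CompleteSpace E]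

/-- Near a point of a regular curve contained in a level set of `H`, and spanning together with the
gradient of `H` the whole space, the distance to the curve is controlled by the variation of `H`. -/
theorem eventually_infDist_le_of_hasStrictFDerivAt {Γ : Set E} {γ : ℝ → E} {θ₀ : ℝ} {w N : E}
    {H : E → ℝ} {h : ℝ} (hγ : HasStrictDerivAt γ w θ₀) (hγΓ : ∀ θ, γ θ ∈ Γ)
    (hH : HasStrictFDerivAt H (innerSL ℝ N) (γ θ₀)) (hHγ : ∀ θ, H (γ θ) = h) (hN : N ≠ 0)
    (hspan : ∀ v : E, ∃ a b : ℝ, a • w + b • N = v) :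
    ∀ᶠ y in 𝓝 (γ θ₀), infDist y Γ ≤ 2 / ‖N‖ * |H y - h| := by
  have hN' : 0 < ‖N‖ := norm_pos_iff.2 hN
  let F : ℝ × ℝ → E := fun z => γ z.1 + z.2 • N
  let F' : ℝ × ℝ →L[ℝ] E := (ContinuousLinearMap.fst ℝ ℝ ℝ).smulRight w +
    (ContinuousLinearMap.snd ℝ ℝ ℝ).smulRight N
  have hF : HasStrictFDerivAt F F' (θ₀, 0) := by
    refine HasStrictFDerivAt.add ?_ ?_
    · refine (HasStrictFDerivAt.comp (θ₀, (0 : ℝ)) (g := γ) hγ.hasStrictFDerivAt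
        hasStrictFDerivAt_fst).congr_fderiv ?_
      ext <;> simp
    · exact hasStrictFDerivAt_snd.smul_const N
  have hsurj : F'.range = ⊤ := by
    refine LinearMap.range_eq_top.2 fun v => ?_
    obtain ⟨a, b, hab⟩ := hspan v
    exact ⟨(a, b), by simpa [F'] using hab⟩
  have hF0 : F (θ₀, 0) = γ θ₀ := by simp [F]
  have hmap := hF.map_nhds_eq_of_surj hsurj
  rw [hF0] at hmap
  rw [← hmap, eventually_map]
  have hFc : Tendsto F (𝓝 (θ₀, 0)) (𝓝 (γ θ₀)) := hF0 ▸ hF.continuousAt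
  have hγc : Tendsto (fun z : ℝ × ℝ => γ z.1) (𝓝 (θ₀, 0)) (𝓝 (γ θ₀)) :=
    hγ.hasDerivAt.continuousAt.tendsto.comp (continuous_fst.tendsto _)
  have hlin := (hFc.prodMk_nhds hγc).eventually
    (hH.isLittleO.def (half_pos hN'))
  filter_upwards [hlin] with z hz
  have hdiff : F z - γ z.1 = z.2 • N := by simp [F]
  simp only [hdiff, hHγ, map_smul, innerSL_apply_apply, real_inner_self_eq_norm_sq, smul_eq_mul,
    norm_smul, Real.norm_eq_abs] at hz
  have hdist : infDist (F z) Γ ≤ |z.2| * ‖N‖ := by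
    refine (infDist_le_dist_of_mem (hγΓ z.1)).trans_eq ?_
    rw [dist_eq_norm, hdiff, norm_smul, Real.norm_eq_abs]
  have h1 : |z.2| * ‖N‖ ^ 2 - |H (F z) - h| ≤ ‖N‖ / 2 * (|z.2| * ‖N‖) := by
    have := abs_sub_abs_le_abs_sub (z.2 * ‖N‖ ^ 2) (H (F z) - h)
    rw [abs_mul, abs_of_pos (pow_pos hN' 2), abs_sub_comm (z.2 * ‖N‖ ^ 2)] at this
    exact this.trans hz
  refine hdist.trans ?_
  rw [div_mul_eq_mul_div, le_div_iff₀ hN']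
  nlinarith

end TransverseCoordinates

section Cutoff

variable {E F : Type*} [NormedAddCommGroup E] [NormedSpace ℝ E] [FiniteDimensional ℝ E]
  [NormedAddCommGroup F] [NormedSpace ℝ F]

/-- A `C¹` map on an open set agrees on a compact subset with a bounded Lipschitz map. -/
theorem exists_lipschitz_bounded_eqOn_of_contDiffOn {f : E → F} {W S : Set E} (hW : IsOpen W)
    (hf : ContDiffOn ℝ 1 f W) (hS : IsCompact S) (hSW : S ⊆ W) :
    ∃ (v : E → F) (K M : NNReal), LipschitzWith K v ∧ (∀ y, ‖v y‖ ≤ M) ∧ EqOn v f S := by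
  obtain ⟨L, hL, hSL, hLW⟩ := exists_compact_between hS hW hSW
  obtain ⟨φ, hφ1, hφ0, -⟩ := exists_contMDiffMap_one_nhds_of_subset_interior 
    (modelWithCornersSelf ℝ E) (n := 1) hS.isClosed hSL
  have hφs : tsupport φ ⊆ L := closure_minimal
    (fun y hy => by_contra fun hyL => hy (hφ0 y hyL)) hL.isClosed
  have hvs : tsupport (fun y => φ y • f y) ⊆ L := (tsupport_smul_subset_left φ f).trans hφs
  have hv : ContDiff ℝ 1 fun y => φ y • f y := by
    refine contDiff_iff_contDiffAt.2 fun y => ?_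
    by_cases hy : y ∈ tsupport fun y => φ y • f y
    · exact φ.contMDiff.contDiff.contDiffAt.smul (hf.contDiffAt (hW.mem_nhds (hLW (hvs hy))))
    · exact contDiffAt_const.congr_of_eventuallyEq (notMem_tsupport_iff_eventuallyEq.1 hy)
  have hc : HasCompactSupport fun y => φ y • f y := hL.of_isClosed_subset isClosed_closure hvs
  obtain ⟨K, hK⟩ := hv.lipschitzWith_of_hasCompactSupport hc one_ne_zero
  obtain ⟨M, hM⟩ := hc.exists_bound_of_continuous hv.continuous
  refine ⟨fun y => φ y • f y, K, M.toNNReal, hK, fun y => (hM y).trans (Real.le_coe_toNNReal M),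
    fun y hy => ?_⟩
  simp [hφ1.self_of_nhdsSet y hy]

/-- A `C¹` map on an open set is Lipschitz on each of its compact subsets. -/
theorem exists_lipschitzOnWith_of_contDiffOn_of_isCompact {f : E → F} {W S : Set E}
    (hW : IsOpen W) (hf : ContDiffOn ℝ 1 f W) (hS : IsCompact S) (hSW : S ⊆ W) :
    ∃ K, LipschitzOnWith K f S := by
  obtain ⟨v, K, -, hv, -, hvf⟩ := exists_lipschitz_bounded_eqOn_of_contDiffOn hW hf hS hSW
  refine ⟨K, fun y hy z hz => ?_⟩
  rw [← hvf hy, ← hvf hz]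
  exact hv y z

end Cutoff

section Gradient

theorem ContDiffOn.gradient_of_isOpen {F : Type*} [NormedAddCommGroup F] [InnerProductSpace ℝ F]
    [CompleteSpace F] {f : F → ℝ} {s : Set F} {m n : WithTop ℕ∞} (hf : ContDiffOn ℝ n f s)
    (hs : IsOpen s) (hmn : m + 1 ≤ n) : ContDiffOn ℝ m (gradient f) s :=
  (InnerProductSpace.toDual ℝ F).symm.contDiff.comp_contDiffOn (hf.fderiv_of_isOpen hs hmn)

theorem ContDiffAt.hasStrictFDerivAt_gradient {F : Type*} [NormedAddCommGroup F]
    [InnerProductSpace ℝ F] [CompleteSpace F] {f : F → ℝ} {x : F} {n : WithTop ℕ∞}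
    (hf : ContDiffAt ℝ n f x) (hn : n ≠ 0) :
    HasStrictFDerivAt f (innerSL ℝ (gradient f x)) x := by
  refine (hf.hasStrictFDerivAt hn).congr_fderiv ?_
  ext y
  simp

end Gradient

section PlanarRotation

theorem contDiff_J2 {n : WithTop ℕ∞} : ContDiff ℝ n J2 := by
  rw [contDiff_euclidean]
  intro i
  fin_cases i
  · simpa [J2] using contDiff_piLp_apply (n := n) (𝕜 := ℝ) (p := 2)
      (E := fun _ : Fin 2 => ℝ) (i := 1)
  · simpa [J2] using (contDiff_piLp_apply (n := n) (𝕜 := ℝ) (p := 2)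
      (E := fun _ : Fin 2 => ℝ) (i := 0)).neg

theorem inner_J2_self (w : E2) : ⟪w, J2 w⟫ = 0 := by
  simp [J2, PiLp.inner_apply, Fin.sum_univ_two]
  ring

theorem exists_smul_J2_add_smul_eq {m : ℝ} (hm : m ≠ 0) {N : E2} (hN : N ≠ 0) (v : E2) :
    ∃ a b : ℝ, a • (m • J2 N) + b • N = v := by
  have hpos : N 0 ^ 2 + N 1 ^ 2 ≠ 0 := by
    intro h
    refine hN ?_
    ext i
    fin_cases i <;> simp <;> nlinarith [sq_nonneg (N 0), sq_nonneg (N 1)]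
  refine ⟨(v 0 * N 1 - v 1 * N 0) / (m * (N 0 ^ 2 + N 1 ^ 2)),
    (v 0 * N 0 + v 1 * N 1) / (N 0 ^ 2 + N 1 ^ 2), ?_⟩
  ext i
  fin_cases i <;> simp [J2] <;> field_simp <;> ring

end PlanarRotation

/-- For every smooth `α : W → (0,∞)`, `Γ` is a periodic orbit of the
perturbed planar system `v' = μ(v)𝕁∇𝓗(v) − α(v)(𝓗(v)−h)∇𝓗(v)` and is orbitally
phase asymptotically stable with respect to perturbations in `W`. -/
theorem stmt_14
    (Ω : Set E2) (hΩ : IsOpen Ω) (μ 𝓗 : E2 → ℝ)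
    (hμ : ContDiffOn ℝ (⊤ : ℕ∞) μ Ω) (h𝓗 : ContDiffOn ℝ (⊤ : ℕ∞) 𝓗 Ω)
    (W : Set E2) (hW : IsOpen W) (hWΩ : W ⊆ Ω)
    (hgrad : ∀ v ∈ W, gradient 𝓗 v ≠ 0)
    (γ : ℝ → E2) (T : ℝ) (hT : 0 < T)
    (hγW : ∀ t, γ t ∈ W)
    (hsol : ∀ t, HasDerivAt γ (μ (γ t) • J2 (gradient 𝓗 (γ t))) t)
    (hper : ∀ t, γ (t + T) = γ t)
    (hnonconst : ∃ s t, γ s ≠ γ t)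
    (Γ : Set E2) (hΓ : Γ = γ '' Set.Icc 0 T)
    (h : ℝ) (h𝓗γ : ∀ t, 𝓗 (γ t) = h)
    (hreg : ∀ v ∈ Ω, 𝓗 v = h → gradient 𝓗 v ≠ 0)
    (α : E2 → ℝ) (hα : ContDiffOn ℝ (⊤ : ℕ∞) α W) (hαpos : ∀ v ∈ W, 0 < α v)
    (Y : E2 → E2)
    (hY : ∀ v, Y v = μ v • J2 (gradient 𝓗 v) - (α v * (𝓗 v - h)) • gradient 𝓗 v) :
    (∀ t, HasDerivAt γ (Y (γ t)) t) ∧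
      OrbitallyPhaseAsymptoticallyStable Y W W γ Γ := by
  have hgradC : ContDiffOn ℝ 1 (gradient 𝓗) W :=
    (h𝓗.mono hWΩ).gradient_of_isOpen hW (by norm_cast)
  have hμC : ContDiffOn ℝ 1 μ W := (hμ.mono hWΩ).of_le (by norm_cast)
  have h𝓗C : ContDiffOn ℝ 1 𝓗 W := (h𝓗.mono hWΩ).of_le (by norm_cast)
  have hαC : ContDiffOn ℝ 1 α W := hα.of_le (by norm_cast)
  have hYC : ContDiffOn ℝ 1 Y W := by
    rw [funext hY]
    exact (hμC.smul (contDiff_J2.comp_contDiffOn hgradC)).sub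
      ((hαC.mul (h𝓗C.sub contDiffOn_const)).smul hgradC)
  have h𝓗s {v : E2} (hv : v ∈ W) : HasStrictFDerivAt 𝓗 (innerSL ℝ (gradient 𝓗 v)) v :=
    (h𝓗C.contDiffAt (hW.mem_nhds hv)).hasStrictFDerivAt_gradient one_ne_zero
  have hYγ (t : ℝ) : Y (γ t) = μ (γ t) • J2 (gradient 𝓗 (γ t)) := by simp [hY, h𝓗γ]
  have hγ (t : ℝ) : HasDerivAt γ (Y (γ t)) t := hYγ t ▸ hsol t
  refine ⟨hγ, ?_⟩
  have hγcont : Continuous γ := continuous_iff_continuousAt.2 fun t => (hγ t).continuousAt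
  have hΓc : IsCompact Γ := hΓ ▸ isCompact_Icc.image hγcont
  have hΓne : Γ.Nonempty := hΓ ▸ ⟨γ 0, 0, ⟨le_rfl, hT.le⟩, rfl⟩
  have hΓW : Γ ⊆ W := by
    rw [hΓ]
    rintro _ ⟨t, -, rfl⟩
    exact hγW t
  have hγΓ (t : ℝ) : γ t ∈ Γ := by
    obtain ⟨s, hs, hst⟩ := Function.Periodic.exists_mem_Ico₀ hper hT t
    exact hΓ ▸ ⟨s, Ico_subset_Icc_self hs, hst.symm⟩
  have hμγ (t : ℝ) : μ (γ t) ≠ 0 := by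
    intro h0
    obtain ⟨K, hK⟩ := exists_lipschitzOnWith_of_contDiffOn_of_isCompact hW hYC hΓc hΓW
    have hconst : γ = fun _ => γ t := ODE_solution_unique_univ (v := fun _ => Y) (s := fun _ => Γ)
      (t₀ := t) (fun _ => hK) (fun s => ⟨hγ s, hγΓ s⟩)
      (fun s => ⟨by simpa [hYγ, h0] using hasDerivAt_const s (γ t), hγΓ t⟩) rfl
    obtain ⟨s, s', hss'⟩ := hnonconst
    exact hss' ((congrFun hconst s).trans (congrFun hconst s').symm)
  obtain ⟨C, hC0, hC⟩ : ∃ C, 0 ≤ C ∧ ∀ᶠ y in 𝓝ˢ Γ, infDist y Γ ≤ C * |𝓗 y - h| := by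
    refine exists_eventually_nhdsSet_le_mul hΓc (fun _ => abs_nonneg _) fun p hp => ?_
    rw [hΓ] at hp
    obtain ⟨θ, -, rfl⟩ := hp
    refine ⟨_, eventually_infDist_le_of_hasStrictFDerivAt
      (hasStrictDerivAt_of_hasDerivAt_of_continuousAt (Eventually.of_forall hγ) ?_) hγΓ
      (h𝓗s (hγW θ)) h𝓗γ (hgrad _ (hγW θ)) fun v => ?_⟩
    · exact (hYC.contDiffAt (hW.mem_nhds (hγW θ))).continuousAt.comp (f := γ) (hγ θ).continuousAt
    · rw [hYγ]
      exact exists_smul_J2_add_smul_eq (hμγ θ) (hgrad _ (hγW θ)) v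
  obtain ⟨r, hr, hrP⟩ := exists_forall_infDist_le_of_eventually_nhdsSet hΓc hΓne
    (Eventually.and (hW.mem_nhdsSet.2 hΓW) hC)
  set S : Set E2 := {y | infDist y Γ ≤ r} with hS
  have hSW : S ⊆ W := fun y hy => (hrP y hy).1
  have hΓS : Γ ⊆ S := fun y hy => by simpa [hS, infDist_zero_of_mem hy] using hr.le
  have hSc : IsCompact S := by
    refine hΓc.cthickening (r := r) |>.of_isClosed_subset
      (isClosed_le (continuous_infDist_pt Γ) continuous_const) fun y hy => ?_
    rw [mem_cthickening_iff]
    exact (ENNReal.le_ofReal_iff_toReal_le (infEDist_ne_top hΓne) hr.le).2 hy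
  obtain ⟨c, hc, hcS⟩ : ∃ c > 0, ∀ y ∈ S, c ≤ α y * ‖gradient 𝓗 y‖ ^ 2 := by
    obtain ⟨y, hy, hmin⟩ := hSc.exists_isMinOn (hΓne.mono hΓS)
      ((hαC.continuousOn.mono hSW).mul ((hgradC.continuousOn.mono hSW).norm.pow 2))
    exact ⟨_, mul_pos (hαpos y (hSW hy)) (pow_pos (norm_pos_iff.2 (hgrad y (hSW hy))) 2),
      fun z hz => hmin hz⟩
  have hsmall {η : ℝ} (hη : 0 < η) :
      ∃ δ > 0, ∀ y, infDist y Γ ≤ δ → infDist y Γ ≤ r ∧ C * |𝓗 y - h| < η := by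
    refine exists_forall_infDist_le_of_eventually_nhdsSet hΓc hΓne ?_
    refine eventually_nhdsSet_iff_forall.2 fun p hp => .and ?_ ?_
    · have : ∀ᶠ y in 𝓝 p, infDist y Γ < r := (continuous_infDist_pt Γ).continuousAt.eventually_lt
        continuousAt_const (by simpa [infDist_zero_of_mem hp] using hr)
      exact this.mono fun y hy => hy.le
    · have hp' := hΓ ▸ hp
      obtain ⟨θ, -, rfl⟩ := hp'
      exact (((h𝓗s (hγW θ)).continuousAt.sub continuousAt_const).abs.const_mul C).eventually_lt
        continuousAt_const (by simpa [h𝓗γ] using hη)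
  have hdecay {x : ℝ → E2} (hx : ∀ t, 0 ≤ t → ContinuousWithinAt x (Ici 0) t ∧
      (infDist (x t) Γ ≤ r → HasDerivWithinAt x (Y (x t)) (Ici 0) t))
      (t : ℝ) (ht : 0 ≤ t) (hxt : infDist (x t) Γ ≤ r) :
      ∃ a ≥ c, HasDerivWithinAt ((fun y => 𝓗 y - h) ∘ x) (-a * (𝓗 (x t) - h)) (Ici 0) t := by
    refine ⟨_, hcS _ hxt, (((h𝓗s (hSW hxt)).hasFDerivAt.sub_const h).comp_hasDerivWithinAt t
      ((hx t ht).2 hxt)).congr_deriv ?_⟩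
    rw [hY, map_sub, map_smul, map_smul, innerSL_apply_apply, innerSL_apply_apply, inner_J2_self,
      real_inner_self_eq_norm_sq]
    simp only [smul_eq_mul]
    ring
  have hlyap {x : ℝ → E2} (hx : ∀ t, 0 ≤ t → ContinuousWithinAt x (Ici 0) t ∧
      (infDist (x t) Γ ≤ r → HasDerivWithinAt x (Y (x t)) (Ici 0) t)) {ρ : ℝ} (hρ : ρ ≤ r)
      (hx0 : infDist (x 0) Γ ≤ r) (hg0 : C * |𝓗 (x 0) - h| < ρ) {t : ℝ} (ht : 0 ≤ t) :
      infDist (x t) Γ < ρ ∧ |𝓗 (x t) - h| ≤ |𝓗 (x 0) - h| * Real.exp (-c * t) :=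
    infDist_lt_and_abs_le_of_hasDerivWithinAt (g := fun y => 𝓗 y - h) hC0
      (fun y hy => (hrP y hy).2) (fun t ht => (hx t ht).1) (hdecay hx) hρ hc.le hx0 hg0 ht
  have hfwd {x₀ : E2} {x : ℝ → E2} (hx : IsForwardSolution Y W x₀ x) (t : ℝ) (ht : 0 ≤ t) :
      ContinuousWithinAt x (Ici 0) t ∧
        (infDist (x t) Γ ≤ r → HasDerivWithinAt x (Y (x t)) (Ici 0) t) :=
    ⟨(hx.2 t ht).2.continuousWithinAt, fun _ => (hx.2 t ht).2⟩
  obtain ⟨δ, hδ, hδr⟩ := hsmall hr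
  refine ⟨δ, hδ, fun x₀ _ hx₀ => ?_, fun ε hε => ?_, fun x₀ _ hx₀ x hx => ?_⟩
  · obtain ⟨v, K, M, hvK, hvM, hvY⟩ := exists_lipschitz_bounded_eqOn_of_contDiffOn hW hYC hSc hSW
    obtain ⟨x, rfl, hx⟩ := exists_forward_solution_of_lipschitz_of_bounded hvK hvM x₀
    have hin {t : ℝ} (ht : 0 ≤ t) : infDist (x t) Γ ≤ r :=
      (hlyap (fun s hs => ⟨(hx s hs).continuousWithinAt, fun hxs => hvY hxs ▸ hx s hs⟩) le_rfl
        (hδr _ hx₀.le).1 (hδr _ hx₀.le).2 ht).1.le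
    exact ⟨x, rfl, fun t ht => ⟨hSW (hin ht), hvY (hin ht) ▸ hx t ht⟩⟩
  · obtain ⟨δ', hδ', hδε⟩ := hsmall (lt_min hε hr)
    refine ⟨min δ' δ, lt_min hδ' hδ, min_le_right _ _, fun x₀ _ hx₀ x hx t ht => ?_⟩
    have h0 := hδε x₀ (hx₀.le.trans (min_le_left _ _))
    rw [← hx.1] at h0
    exact (hlyap (hfwd hx) (min_le_right _ _) h0.1 h0.2 ht).1.trans_le (min_le_left _ _)
  · have h0 := hδr x₀ hx₀.le
    rw [← hx.1] at h0
    have hin {t : ℝ} (ht : 0 ≤ t) : infDist (x t) Γ ≤ r :=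
      (hlyap (hfwd hx) le_rfl h0.1 h0.2 ht).1.le
    have hbound (t : ℝ) (ht : 0 ≤ t) :
        infDist (x t) Γ ≤ C * |𝓗 (x 0) - h| * Real.exp (-c * t) :=
      ((hrP _ (hin ht)).2.trans (mul_le_mul_of_nonneg_left
        (hlyap (hfwd hx) le_rfl h0.1 h0.2 ht).2 hC0)).trans_eq (mul_assoc _ _ _).symm
    obtain ⟨K, hK⟩ := exists_lipschitzOnWith_of_contDiffOn_of_isCompact hW hYC hSc hSW
    refine ⟨?_, exists_asymptotic_phase hK hT hγ hper hΓ (fun t => hΓS (hγΓ t))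
      (fun t ht => (hx.2 t ht).2) (fun t ht => hin ht) hc hbound⟩
    refine squeeze_zero' (Eventually.of_forall fun _ => infDist_nonneg)
      ((eventually_ge_atTop 0).mono hbound) ?_
    have hexp : Tendsto (fun t => Real.exp (-c * t)) atTop (𝓝 0) :=
      Real.tendsto_exp_atBot.comp (tendsto_id.const_mul_atTop_of_neg (neg_lt_zero.2 hc))
    simpa using hexp.const_mul (C * |𝓗 (x 0) - h|)
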